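/- Let A be an (associative, not necessarily commutative) algebra over the complex numbers, let (D₁, d₁) and (D₂, d₂) be generalized derivations on A, and let α ∈ ℂ. If the pair (αD₁³ + D₁∘D₂, αd₁³ + d₁∘d₂) is again a generalized derivation on A, then the map d₂∘D₁ sends A into the Jacobson radical rad(A) of A. -/

import Mathlib

/-- An additive map `d : R → R` with `d (x*y) = d x * y + x * d y` is a derivation. -/
def IsDerivation {R : Type*} [Ring R] (d : R → R) : Prop :=
  (∀ x y, d (x + y) = d x + d y) ∧ (∀ x y, d (x * y) = d x * y + x * d y)

/-- A generalized derivation `(D, d)`: `D` additive, `d` a derivation, and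
`D (x*y) = D x * y + x * d y`. -/
def IsGenDerivation {R : Type*} [Ring R] (D d : R → R) : Prop :=
  (∀ x y, D (x + y) = D x + D y) ∧ IsDerivation d ∧ (∀ x y, D (x * y) = D x * y + x * d y)

theorem IsGenDerivation.isDerivation {R : Type*} [Ring R] {D d : R → R}
    (h : IsGenDerivation D d) : IsDerivation d :=
  h.2.1

/-- A derivation, seen as a generalized derivation. -/
theorem IsDerivation.isGenDerivation {R : Type*} [Ring R] {d : R → R}
    (h : IsDerivation d) : IsGenDerivation d d :=
  ⟨h.1, h, h.2⟩

theorem IsDerivation.map_zero {R : Type*} [Ring R] {d : R → R} (h : IsDerivation d) :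
    d 0 = 0 := by
  simpa using h.1 0 0

/-- The polarized form of the condition that `α D₁³ + D₁ D₂` is a generalized derivation. -/
theorem IsGenDerivation.cubic_identity {A : Type*} [Ring A] [Algebra ℂ A]
    {D₁ d₁ D₂ d₂ : A → A} {α : ℂ}
    (h₁ : IsGenDerivation D₁ d₁) (h₂ : IsGenDerivation D₂ d₂)
    (h : IsGenDerivation (fun x => α • D₁ (D₁ (D₁ x)) + D₁ (D₂ x))
      (fun x => α • d₁ (d₁ (d₁ x)) + d₁ (d₂ x))) (x y : A) :
    (D₂ x + (3 * α) • D₁ (D₁ x)) * d₁ y + D₁ x * (d₂ y + (3 * α) • d₁ (d₁ y)) = 0 := by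
  have key := h.2.2 x y
  simp only [h₁.2.2, h₂.2.2, h₁.1, mul_add, add_mul, smul_add,
    smul_mul_assoc, mul_smul_comm] at key ⊢
  linear_combination (norm := module) key

/-- A version of `IsGenDerivation.cubic_identity` with a free middle factor. -/
theorem IsGenDerivation.cubic_identity_middle {A : Type*} [Ring A] [Algebra ℂ A]
    {D₁ d₁ D₂ d₂ : A → A} {α : ℂ}
    (h₁ : IsGenDerivation D₁ d₁) (h₂ : IsGenDerivation D₂ d₂)
    (h : IsGenDerivation (fun x => α • D₁ (D₁ (D₁ x)) + D₁ (D₂ x))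
      (fun x => α • d₁ (d₁ (d₁ x)) + d₁ (d₂ x))) (x z y : A) :
    (D₂ x + (3 * α) • D₁ (D₁ x)) * (z * d₁ y) + D₁ x * (z * (d₂ y + (3 * α) • d₁ (d₁ y)))
      + (6 * α) • (D₁ x * (d₁ z * d₁ y)) = 0 := by
  have hz := congrArg (· * y) (cubic_identity h₁ h₂ h x z)
  have hzy := cubic_identity h₁ h₂ h x (z * y)
  simp only [h₁.isDerivation.2, h₂.isDerivation.2, h₁.isDerivation.1, mul_add, add_mul,
    smul_add, smul_mul_assoc, mul_smul_comm, mul_assoc, zero_mul] at hz hzy ⊢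
  linear_combination (norm := module) hzy - hz

/-- If `α d₁³ + d₁ d₂` is a derivation, then `d₁ x z d₂ y r d₁ w` vanishes identically. -/
theorem IsDerivation.mul_mul_mul_mul_eq_zero {A : Type*} [Ring A] [Algebra ℂ A]
    {d₁ d₂ : A → A} {α : ℂ} (h₁ : IsDerivation d₁) (h₂ : IsDerivation d₂)
    (h : IsDerivation (fun x => α • d₁ (d₁ (d₁ x)) + d₁ (d₂ x))) (x z y r w : A) :
    d₁ x * (z * (d₂ y * (r * d₁ w))) = 0 := by
  have key := IsGenDerivation.cubic_identity_middle h₁.isGenDerivation h₂.isGenDerivation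
    h.isGenDerivation
  have hxy := congrArg (· * (r * d₁ w)) (key x z y)
  have hxw := key x (z * (d₁ y * r)) w
  have hyw := congrArg (fun t => d₁ x * (z * t)) (key y r w)
  simp only [h₁.2, mul_add, add_mul, smul_add, smul_mul_assoc, mul_smul_comm, mul_assoc,
    zero_mul, mul_zero] at hxy hxw hyw ⊢
  linear_combination (norm := module)
    (1 / 2 : ℂ) • hxy - (1 / 2 : ℂ) • hxw + (1 / 2 : ℂ) • hyw

/-- The annihilator of a simple module is a prime ideal. -/
theorem IsSimpleModule.toAddMonoidEnd_eq_zero_or {A S : Type*} [Ring A] [AddCommGroup S]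
    [Module A S] [IsSimpleModule A S] {a b : A}
    (h : ∀ r, Module.toAddMonoidEnd A S (a * (r * b)) = 0) :
    Module.toAddMonoidEnd A S a = 0 ∨ Module.toAddMonoidEnd A S b = 0 := by
  by_contra! hab
  obtain ⟨s, hs⟩ := DFunLike.ne_iff.mp hab.2
  refine hab.1 (AddMonoidHom.ext fun t => ?_)
  obtain ⟨r, rfl⟩ := IsSimpleModule.toSpanSingleton_surjective A hs t
  have hrs := DFunLike.congr_fun (h r) s
  rwa [map_mul, map_mul] at hrs

/-- A ring homomorphism `q` whose kernel is prime kills `d₂ ∘ D₁`. -/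
theorem IsGenDerivation.map_comp_eq_zero {A B : Type*} [Ring A] [Algebra ℂ A] [Ring B]
    {D₁ d₁ D₂ d₂ : A → A} {α : ℂ}
    (h₁ : IsGenDerivation D₁ d₁) (h₂ : IsGenDerivation D₂ d₂)
    (h : IsGenDerivation (fun x => α • D₁ (D₁ (D₁ x)) + D₁ (D₂ x))
      (fun x => α • d₁ (d₁ (d₁ x)) + d₁ (d₂ x)))
    (q : A →+* B) (hq : ∀ a b, (∀ r, q (a * (r * b)) = 0) → q a = 0 ∨ q b = 0) (x : A) :
    q (d₂ (D₁ x)) = 0 := by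
  have hsmul (c : ℂ) {a : A} (ha : q a = 0) : q (c • a) = 0 := by
    rw [Algebra.smul_def, map_mul, ha, mul_zero]
  by_cases hd₂ : ∀ y, q (d₂ y) = 0
  · exact hd₂ _
  obtain ⟨y₀, hy₀⟩ := not_forall.mp hd₂
  have hd := IsDerivation.mul_mul_mul_mul_eq_zero h₁.isDerivation h₂.isDerivation h.isDerivation
  have hD := cubic_identity_middle h₁ h₂ h
  have hd₁ (w : A) : q (d₁ w) = 0 := by
    by_contra hw
    refine (hq (d₂ y₀) (d₁ w) fun r => ?_).elim hy₀ hw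
    exact (hq (d₁ w) (d₂ y₀ * (r * d₁ w)) fun z => by rw [hd, map_zero]).resolve_left hw
  have hD₁ (x : A) : q (D₁ x) = 0 := by
    refine (hq (D₁ x) (d₂ y₀) fun z => ?_).resolve_right hy₀
    simpa [hd₁, hsmul] using congrArg q (hD x z y₀)
  have hd₂d₁ (w : A) : q (d₂ (d₁ w)) = 0 := by
    by_contra hw
    refine (hq (d₂ y₀) (d₂ (d₁ w)) fun r => ?_).elim hy₀ hw
    refine (hq (d₂ (d₁ w)) (d₂ y₀ * (r * d₂ (d₁ w))) fun z => ?_).resolve_left hw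
    have key := congrArg (fun t => q (d₂ (d₂ t))) (hd w z y₀ r w)
    simp only [h₂.isDerivation.1, h₂.isDerivation.2, h₂.isDerivation.map_zero, map_add, map_mul,
      hd₁, zero_mul, mul_zero, add_zero, zero_add, map_zero, mul_add] at key
    have half := hsmul (1 / 2)
      (a := d₂ (d₁ w) * (z * (d₂ y₀ * (r * d₂ (d₁ w)))) +
        d₂ (d₁ w) * (z * (d₂ y₀ * (r * d₂ (d₁ w))))) (by simpa using key)
    rwa [← two_smul ℂ, smul_smul, one_div, inv_mul_cancel₀ two_ne_zero, one_smul] at half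
  refine (hq (d₂ (D₁ x)) (d₂ y₀) fun z => ?_).resolve_right hy₀
  have key := congrArg (fun t => q (d₂ t)) (hD x z y₀)
  rw [← mul_smul_comm, ← mul_smul_comm] at key
  simpa only [h₂.isDerivation.1, h₂.isDerivation.2, h₂.isDerivation.map_zero, map_add, map_mul,
    map_zero, hd₁, hD₁, hd₂d₁, hsmul, mul_zero, zero_mul, add_zero, zero_add] using key


theorem stmt0 {A : Type*} [Ring A] [Algebra ℂ A]
    (D₁ d₁ D₂ d₂ : A → A) (α : ℂ)
    (h₁ : IsGenDerivation D₁ d₁) (h₂ : IsGenDerivation D₂ d₂)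
    (h : IsGenDerivation (fun x => α • D₁ (D₁ (D₁ x)) + D₁ (D₂ x))
      (fun x => α • d₁ (d₁ (d₁ x)) + d₁ (d₂ x))) :
    ∀ x : A, d₂ (D₁ x) ∈ Ideal.jacobson (⊥ : Ideal A) := by
  intro x
  refine Ideal.mem_sInf.mpr fun {M} hM => ?_
  have : IsSimpleModule A (A ⧸ M) := isSimpleModule_iff_isCoatom.mpr hM.2.out
  have hx := h₁.map_comp_eq_zero h₂ h (Module.toAddMonoidEnd A (A ⧸ M))
    (fun _ _ => IsSimpleModule.toAddMonoidEnd_eq_zero_or) x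
  rw [← Submodule.Quotient.mk_eq_zero]
  have hx1 : d₂ (D₁ x) • (Submodule.Quotient.mk 1 : A ⧸ M) = 0 := DFunLike.congr_fun hx _
  rwa [← Submodule.Quotient.mk_smul, smul_eq_mul, mul_one] at hx1
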